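/- The ratio s_n/i_n of the character table sum of S_n to the number of involutions in S_n converges to 1 as n → ∞. -/

import Mathlib

open CategoryTheory Filter Topology

/-- `S` is the (finite) set of irreducible complex characters of `G`. -/
def IsIrrFamily (G : Type) [Group G] (S : Finset (G → ℂ)) : Prop :=
  (∀ f ∈ S, ∃ V : FDRep ℂ G, Simple V ∧ V.character = f) ∧
  ∀ V : FDRep ℂ G, Simple V → V.character ∈ S

/-- The character table sum. -/
noncomputable def tableSum (G : Type) [Group G] (S : Finset (G → ℂ)) : ℂ :=
  ∑ f ∈ S, ∑ᶠ C : ConjClasses G, f (Quotient.out C)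

/-- The number of involutions in `S_k`. -/
noncomputable def numInvolutions (k : ℕ) : ℕ :=
  Nat.card {x : Equiv.Perm (Fin k) // x ^ 2 = 1}

namespace Representation
open scoped MonoidAlgebra

section Irreducible

variable {k G V : Type*} [Field k] [Group G] [AddCommGroup V] [Module k V]

/-- Burnside's theorem: the group algebra surjects onto the endomorphisms of an irreducible
representation. -/
theorem IsIrreducible.asAlgebraHom_surjective [IsAlgClosed k] [FiniteDimensional k V]
    (ρ : Representation k G V) [IsIrreducible ρ] : Function.Surjective ρ.asAlgebraHom := by
  classical
  intro T
  have hbij : Function.Bijective (algebraMap k (Module.End k[G] ρ.asModule)) :=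
    IsSimpleModule.algebraMap_end_bijective_of_isAlgClosed k
  let T' : Module.End (Module.End k[G] ρ.asModule) ρ.asModule :=
    { toFun := fun v => ρ.asModuleEquiv.symm (T (ρ.asModuleEquiv v))
      map_add' := by intro x y; simp
      map_smul' := by
        intro f x
        obtain ⟨c, rfl⟩ := hbij.2 f
        simp }
  let b := Module.finBasis k ρ.asModule
  obtain ⟨r, hr⟩ := jacobson_density T' (Finset.univ.image b)
  refine ⟨r, ?_⟩
  refine (b.map ρ.asModuleEquiv).ext fun i => ?_
  have := hr (b i) (by simp)
  simp only [Module.Basis.map_apply]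
  rw [← asModuleEquiv_map_smul, ← this]
  simp [T']

/-- Every nonzero subrepresentation of a finite-dimensional representation contains an
irreducible one. -/
theorem _root_.Subrepresentation.exists_le_isIrreducible [FiniteDimensional k V]
    {ρ : Representation k G V} (C : Subrepresentation ρ) (hC : C.toSubmodule ≠ ⊥) :
    ∃ W : Subrepresentation ρ, W.toSubmodule ≤ C.toSubmodule ∧
      IsIrreducible W.toRepresentation := by
  have key : ∀ n : ℕ, ∀ C : Subrepresentation ρ, C.toSubmodule ≠ ⊥ →
      Module.finrank k C.toSubmodule = n → ∃ W : Subrepresentation ρ,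
        W.toSubmodule ≤ C.toSubmodule ∧ IsIrreducible W.toRepresentation := by
    intro n
    induction n using Nat.strong_induction_on with
    | _ n ih =>
      intro C hC hn
      by_cases hirr : IsIrreducible C.toRepresentation
      · exact ⟨C, le_rfl, hirr⟩
      have hnt : Nontrivial (Subrepresentation C.toRepresentation) := by
        refine ⟨⊥, ⊤, fun h => hC ?_⟩
        rw [eq_bot_iff]
        intro v hv
        have : (⟨v, hv⟩ : C.toSubmodule) ∈ (⊤ : Subrepresentation C.toRepresentation) :=
          Submodule.mem_top
        rw [← h] at this
        have h0 : (⟨v, hv⟩ : C.toSubmodule) = 0 := this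
        simpa using congrArg Subtype.val h0
      have : ∃ U : Subrepresentation C.toRepresentation, U ≠ ⊥ ∧ U ≠ ⊤ := by
        by_contra! h
        exact hirr ⟨fun U => or_iff_not_imp_left.mpr (h U)⟩
      obtain ⟨U, hU0, hU1⟩ := this
      let U' : Subrepresentation ρ := ⟨U.toSubmodule.map C.toSubmodule.subtype, by
        rintro g _ ⟨u, hu, rfl⟩
        exact ⟨_, U.apply_mem_toSubmodule g hu, rfl⟩⟩
      have hle : U'.toSubmodule ≤ C.toSubmodule := Submodule.map_subtype_le _ _
      have hlt : U'.toSubmodule < C.toSubmodule := by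
        refine lt_of_le_of_ne hle fun h => hU1 ?_
        apply Subrepresentation.toSubmodule_injective
        change U.toSubmodule = ⊤
        rw [eq_top_iff]
        rintro ⟨v, hv⟩ -
        obtain ⟨u, hu, huv⟩ := h.ge hv
        have : u = ⟨v, hv⟩ := Subtype.ext huv
        rwa [← this]
      have hne : U'.toSubmodule ≠ ⊥ := by
        intro h
        apply hU0
        apply Subrepresentation.toSubmodule_injective
        change U.toSubmodule = ⊥
        exact Submodule.map_injective_of_injective C.toSubmodule.injective_subtype
          (by simpa using h)
      obtain ⟨W, hW, hWi⟩ := ih _ (hn ▸ Submodule.finrank_lt_finrank_of_lt hlt) U' hne rfl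
      exact ⟨W, hW.trans hle, hWi⟩
  exact key _ C hC rfl

theorem _root_.Subrepresentation.exists_isCompl_toSubmodule [Finite G] [CharZero k]
    {ρ : Representation k G V} (W : Subrepresentation ρ) :
    ∃ C : Subrepresentation ρ, IsCompl W.toSubmodule C.toSubmodule := by
  have : NeZero (Nat.card G : k) := ⟨Nat.cast_ne_zero.mpr Nat.card_pos.ne'⟩
  obtain ⟨C, hC⟩ := exists_isCompl W
  refine ⟨C, ?_⟩
  rw [isCompl_iff, disjoint_iff, codisjoint_iff] at hC ⊢
  exact ⟨congrArg Subrepresentation.toSubmodule hC.1, congrArg Subrepresentation.toSubmodule hC.2⟩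

theorem IsIrreducible.nontrivial_carrier (ρ : Representation k G V) [IsIrreducible ρ] :
    Nontrivial V :=
  IsSimpleModule.nontrivial k[G] ρ.asModule

theorem IsIrreducible.eq_bot_or_eq_top_of_invariant (ρ : Representation k G V) [IsIrreducible ρ]
    (p : Submodule k V) (hp : ∀ g, ∀ v ∈ p, ρ g v ∈ p) : p = ⊥ ∨ p = ⊤ := by
  rcases eq_bot_or_eq_top (⟨p, fun g v hv => hp g v hv⟩ : Subrepresentation ρ) with h | h
  · exact Or.inl (congrArg Subrepresentation.toSubmodule h)
  · exact Or.inr (congrArg Subrepresentation.toSubmodule h)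

/-- If the operator `∑ g, f g • ρ g` attached to a class function `f` vanishes on every
irreducible representation, then it vanishes on every representation. -/
theorem sum_smul_eq_zero_of_irreducible {G V : Type} [Group G] [Fintype G] [CharZero k]
    [AddCommGroup V] [Module k V] [FiniteDimensional k V]
    (f : G → k) (hf : ∀ g h, f (h * g * h⁻¹) = f g)
    (h0 : ∀ (W : Type) [AddCommGroup W] [Module k W] [FiniteDimensional k W]
      (σ : Representation k G W) [IsIrreducible σ], ∑ g, f g • σ g = 0)
    (ρ : Representation k G V) : ∑ g, f g • ρ g = 0 := by
  set A := ∑ g, f g • ρ g with hA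
  have hcomm : ∀ h, ρ h * A = A * ρ h := by
    intro h
    rw [hA, Finset.mul_sum, Finset.sum_mul]
    refine Fintype.sum_equiv (MulAut.conj h).toEquiv _ _ fun g => ?_
    simp [hf, ← map_mul]
  let K : Subrepresentation ρ := ⟨LinearMap.ker A, fun h v hv => by
    have := congrArg (fun T => T v) (hcomm h)
    simp only [Module.End.mul_apply, LinearMap.mem_ker.mp hv, map_zero] at this
    exact this.symm⟩
  obtain ⟨C, hC⟩ := K.exists_isCompl_toSubmodule
  by_cases hbot : C.toSubmodule = ⊥
  · rw [hbot] at hC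
    exact LinearMap.ker_eq_top.mp (eq_top_of_isCompl_bot hC)
  exfalso
  obtain ⟨W, hWC, hW⟩ := C.exists_le_isIrreducible hbot
  have hnt := IsIrreducible.nontrivial_carrier W.toRepresentation
  obtain ⟨w, hw⟩ := exists_ne (0 : W.toSubmodule)
  have hz := congrArg (fun T => ((T w : W.toSubmodule) : V)) (h0 _ W.toRepresentation)
  have hAw : A w = 0 := by
    rw [hA]
    simp only [LinearMap.sum_apply, LinearMap.smul_apply] at hz ⊢
    refine Eq.trans ?_ hz
    rw [AddSubmonoidClass.coe_finsetSum]
    rfl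
  have := (Submodule.disjoint_def.mp hC.disjoint) w hAw (hWC w.2)
  exact hw (Subtype.ext this)

end Irreducible

section Bilinear

variable {k G H V : Type} [Field k] [IsAlgClosed k] [CharZero k] [Group G] [Fintype G] [Group H]
  [Fintype H] [AddCommGroup V] [Module k V] [FiniteDimensional k V]

omit [Fintype G] in
/-- If every element of `G` is conjugate to its inverse under `H`, then every `H`-equivariant
endomorphism of an irreducible representation of `G` is self-adjoint for every `G`-invariant
bilinear form. -/
theorem IsIrreducible.apply_eq_of_commute (φ : H →* G)
    (hφ : ∀ g, ∃ h, φ h * g * (φ h)⁻¹ = g⁻¹) (ρ : Representation k G V) [IsIrreducible ρ]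
    (B : V →ₗ[k] V →ₗ[k] k) (hB : ∀ g v w, B (ρ g v) (ρ g w) = B v w)
    (T : V →ₗ[k] V) (hT : ∀ h, ρ (φ h) * T = T * ρ (φ h)) (v w : V) :
    B (T v) w = B v (T w) := by
  have hB' : ∀ g v w, B (ρ g v) w = B v (ρ g⁻¹ w) := fun g v w => by
    rw [← hB g v (ρ g⁻¹ w), ← Module.End.mul_apply, ← map_mul]
    simp
  let Φ : (V →ₗ[k] V) →ₗ[k] k := ∑ h : H,
    ((B.flip w ∘ₗ LinearMap.applyₗ v - B v ∘ₗ LinearMap.applyₗ w) ∘ₗ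
      LinearMap.mulLeft k (ρ (φ h)) ∘ₗ LinearMap.mulRight k (ρ (φ h)⁻¹))
  have hΦ : ∀ S : V →ₗ[k] V, Φ S = ∑ h : H, (B ((ρ (φ h) * (S * ρ (φ h)⁻¹)) v) w -
      B v ((ρ (φ h) * (S * ρ (φ h)⁻¹)) w)) := fun S => by
    simp [Φ, LinearMap.sum_apply]
  have hΦρ : ∀ g, Φ (ρ g) = 0 := fun g => by
    obtain ⟨t, ht⟩ := hφ g
    rw [hΦ, Finset.sum_sub_distrib, sub_eq_zero]
    simp only [← map_mul, hB']
    refine Fintype.sum_equiv (Equiv.mulRight t) _ _ fun h => ?_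
    congr 3
    simp only [Equiv.coe_mulRight, map_mul, mul_inv_rev, inv_inv, ← ht]
    group
  have hΦ0 : Φ = 0 := by
    ext S
    obtain ⟨a, rfl⟩ := IsIrreducible.asAlgebraHom_surjective ρ S
    induction a using MonoidAlgebra.induction_linear with
    | zero => simp
    | add x y hx hy => simp [hx, hy]
    | single g c => simp [hΦρ]
  have h1 := hΦ T
  have h2 : ∀ h : H, ρ (φ h) * (T * ρ (φ h)⁻¹) = T := fun h => by
    rw [← mul_assoc, hT, mul_assoc, ← map_mul]
    simp
  simp only [h2, hΦ0, LinearMap.zero_apply, Finset.sum_const, Finset.card_univ] at h1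
  rw [eq_comm, smul_eq_zero] at h1
  exact sub_eq_zero.mp (h1.resolve_left Fintype.card_ne_zero)

omit [Fintype G] in
/-- If every element of `G` is conjugate to its inverse under `H`, and no irreducible
representation of `H` carries a nonzero invariant alternating form, then the same holds for `G`. -/
theorem IsIrreducible.eq_zero_of_isAlt (φ : H →* G)
    (hφ : ∀ g, ∃ h, φ h * g * (φ h)⁻¹ = g⁻¹)
    (hH : ∀ (W : Type) [AddCommGroup W] [Module k W] [FiniteDimensional k W]
      (σ : Representation k H W) [IsIrreducible σ] (B : W →ₗ[k] W →ₗ[k] k),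
      (∀ h v w, B (σ h v) (σ h w) = B v w) → (∀ v, B v v = 0) → B = 0)
    (ρ : Representation k G V) [IsIrreducible ρ]
    (B : V →ₗ[k] V →ₗ[k] k) (hB : ∀ g v w, B (ρ g v) (ρ g w) = B v w) (hB0 : ∀ v, B v v = 0) :
    B = 0 := by
  have hnt := IsIrreducible.nontrivial_carrier ρ
  let τ : Representation k H V := ρ.comp φ
  obtain ⟨W, -, hW⟩ := Subrepresentation.exists_le_isIrreducible
    (⟨⊤, fun _ _ _ => Submodule.mem_top⟩ : Subrepresentation τ) (by simp)
  obtain ⟨C, hC⟩ := W.exists_isCompl_toSubmodule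
  have hWB := hH _ W.toRepresentation
    (B.compl₁₂ W.toSubmodule.subtype W.toSubmodule.subtype)
    (fun h v w => hB (φ h) v w) (fun v => hB0 v)
  have hnt := IsIrreducible.nontrivial_carrier W.toRepresentation
  obtain ⟨w, hw⟩ := exists_ne (0 : W.toSubmodule)
  let T : V →ₗ[k] V := Submodule.projection _ _ hC
  have hTW : ∀ v ∈ W.toSubmodule, T v = v :=
    fun v hv => Submodule.projection_apply_of_mem_left hC hv
  have hTC : ∀ v ∈ C.toSubmodule, T v = 0 :=
    fun v hv => (Submodule.projection_apply_eq_zero_iff hC).mpr hv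
  have hTm : ∀ v, T v ∈ W.toSubmodule := fun v => Submodule.projection_apply_mem hC v
  have hT : ∀ h, ρ (φ h) * T = T * ρ (φ h) := fun h => by
    ext v
    obtain ⟨a, ha, b, hb, rfl⟩ := Submodule.mem_sup.mp
      (hC.sup_eq_top.ge (Submodule.mem_top (x := v)))
    have h1 : T (ρ (φ h) a) = ρ (φ h) a := hTW _ (W.apply_mem_toSubmodule h ha)
    have h2 : T (ρ (φ h) b) = 0 := hTC _ (C.apply_mem_toSubmodule h hb)
    simp only [Module.End.mul_apply, map_add, hTW a ha, hTC b hb, h1, h2, map_zero]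
  have hwker : B w = 0 := by
    ext v
    rw [← hTW w w.2, IsIrreducible.apply_eq_of_commute φ hφ ρ B hB T hT]
    exact congrArg (fun F => F w ⟨T v, hTm v⟩) hWB
  rcases IsIrreducible.eq_bot_or_eq_top_of_invariant ρ (LinearMap.ker B) (fun g v hv => by
    ext u
    have := hB g v (ρ g⁻¹ u)
    rw [← Module.End.mul_apply, ← map_mul, LinearMap.mem_ker.mp hv] at this
    simpa using this) with h | h
  · exact absurd (Subtype.ext ((Submodule.mem_bot k).mp (h.le hwker))) hw
  · exact LinearMap.ker_eq_top.mp h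

end Bilinear
end Representation

theorem Equiv.Perm.exists_conj_eq_inv {α : Type*} (σ : Equiv.Perm α) (a : α) :
    ∃ τ : Equiv.Perm α, τ a = a ∧ τ * σ * τ⁻¹ = σ⁻¹ := by
  classical
  let S := Equiv.Perm.SameCycle.setoid σ
  let b : α → α := fun x => if σ.SameCycle a x then a else (Quotient.mk S x).out
  have hb : ∀ x, σ.SameCycle (b x) x := fun x => by
    by_cases h : σ.SameCycle a x
    · simp [b, h]
    · simp only [b, h, if_false]
      exact Quotient.exact (Quotient.out_eq (Quotient.mk S x))
  have hbc : ∀ x y, σ.SameCycle x y → b x = b y := fun x y h => by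
    have : σ.SameCycle a x ↔ σ.SameCycle a y := ⟨fun h' => h'.trans h, fun h' => h'.trans h.symm⟩
    have h2 : Quotient.mk S x = Quotient.mk S y := Quotient.sound h
    simp only [b, this, h2]
  choose e he using hb
  have key : ∀ x (i : ℤ), (σ ^ i) (b x) = x → (σ ^ (-i)) (b x) = (σ ^ (-e x)) (b x) := by
    intro x i hi
    have h1 : (σ ^ i) (b x) = (σ ^ e x) (b x) := by rw [hi, he]
    have h2 : (σ ^ (-i - e x)) ((σ ^ i) (b x)) = (σ ^ (-i - e x)) ((σ ^ e x) (b x)) := by rw [h1]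
    rw [← Equiv.Perm.mul_apply, ← Equiv.Perm.mul_apply, ← zpow_add, ← zpow_add] at h2
    rw [show -i - e x + i = -e x by ring, show -i - e x + e x = -i by ring] at h2
    exact h2.symm
  let t : α → α := fun x => (σ ^ (-e x)) (b x)
  have htb : ∀ x, b (t x) = b x := fun x => by
    refine hbc _ _ (Equiv.Perm.SameCycle.symm ⟨-e x - e x, ?_⟩)
    calc (σ ^ (-e x - e x)) x = (σ ^ (-e x - e x)) ((σ ^ e x) (b x)) := by rw [he]
      _ = t x := by rw [← Equiv.Perm.mul_apply, ← zpow_add, sub_add_cancel]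
  have htt : ∀ x, t (t x) = x := fun x => by
    have := key (t x) (-e x) (by rw [htb])
    rw [htb, neg_neg, he] at this
    change (σ ^ (-e (t x))) (b (t x)) = x
    rw [htb, ← this]
  let τ : Equiv.Perm α := ⟨t, t, htt, htt⟩
  have hcomm : ∀ x, t (σ x) = σ⁻¹ (t x) := fun x => by
    have hbx : b (σ x) = b x := hbc _ _ (Equiv.Perm.SameCycle.symm ⟨1, by simp⟩)
    have := key (σ x) (1 + e x) (by rw [hbx, zpow_add, Equiv.Perm.mul_apply, he]; simp)
    change (σ ^ (-e (σ x))) (b (σ x)) = _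
    rw [← this, hbx, neg_add, zpow_add, Equiv.Perm.mul_apply]
    simp [t]
  refine ⟨τ, ?_, ?_⟩
  · have hba : b a = a := by simp [b, Equiv.Perm.SameCycle.refl]
    have := key a 0 (by simp [hba])
    change (σ ^ (-e a)) (b a) = a
    rw [← this]
    simp [hba]
  · rw [mul_inv_eq_iff_eq_mul]
    ext x
    exact hcomm x

namespace Representation

section FrobeniusSchur

variable {k G V : Type} [Field k] [IsAlgClosed k] [CharZero k] [Group G] [Fintype G]
  [AddCommGroup V] [Module k V] [FiniteDimensional k V]

theorem IsIrreducible.sum_char_mul_char_inv (ρ : Representation k G V) [IsIrreducible ρ] :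
    ∑ g, ρ.character g * ρ.character g⁻¹ = Nat.card G := by
  have hne : (Nat.card G : k) ≠ 0 := Nat.cast_ne_zero.mpr Nat.card_pos.ne'
  have := invertibleOfNonzero hne
  have h := char_orthonormal ρ ρ
  rw [if_pos ⟨Equiv.refl ρ⟩, inv_mul_eq_iff_eq_mul₀ hne, mul_one] at h
  exact h

theorem IsIrreducible.sum_char_mul_char_inv_of_ne {W : Type} [AddCommGroup W] [Module k W]
    [FiniteDimensional k W] (ρ : Representation k G V) [IsIrreducible ρ]
    (σ : Representation k G W) [IsIrreducible σ] (h : ρ.character ≠ σ.character) :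
    ∑ g, ρ.character g * σ.character g⁻¹ = 0 := by
  have hne : (Nat.card G : k) ≠ 0 := Nat.cast_ne_zero.mpr Nat.card_pos.ne'
  have := invertibleOfNonzero hne
  have h2 := char_orthonormal ρ σ
  rw [if_neg (fun ⟨e⟩ => h (char_iso e).symm)] at h2
  exact (mul_eq_zero.mp h2).resolve_left (inv_ne_zero hne)

/-- If an irreducible representation with inverse-invariant character has no nonzero invariant
alternating form, then its Frobenius-Schur indicator is `1`. -/
theorem IsIrreducible.sum_char_sq (ρ : Representation k G V) [IsIrreducible ρ]
    (hinv : ∀ g, ρ.character g⁻¹ = ρ.character g)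
    (halt : ∀ B : V →ₗ[k] V →ₗ[k] k,
      (∀ g v w, B (ρ g v) (ρ g w) = B v w) → (∀ v, B v v = 0) → B = 0) :
    ∑ g, ρ.character (g ^ 2) = Nat.card G := by
  rw [← sum_char_mul_char_inv ρ]
  let b := Module.finBasis k V
  have htr : ∀ T : V →ₗ[k] V, LinearMap.trace k V T = ∑ i, b.coord i (T (b i)) := fun T => by
    rw [LinearMap.trace_eq_matrix_trace k b, Matrix.trace]
    simp [LinearMap.toMatrix_apply]
  have hsymm : ∀ i j v w, ∑ g, b.coord i (ρ g v) * b.coord j (ρ g w) =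
      ∑ g, b.coord i (ρ g w) * b.coord j (ρ g v) := by
    intro i j v w
    let B : V →ₗ[k] V →ₗ[k] k := ∑ g,
      ((LinearMap.mul k k).compl₁₂ (b.coord i ∘ₗ ρ g) (b.coord j ∘ₗ ρ g) -
        ((LinearMap.mul k k).compl₁₂ (b.coord i ∘ₗ ρ g) (b.coord j ∘ₗ ρ g)).flip)
    have hBv : ∀ v w, B v w = ∑ g, (b.coord i (ρ g v) * b.coord j (ρ g w) -
        b.coord i (ρ g w) * b.coord j (ρ g v)) := fun v w => by
      simp [B, LinearMap.sum_apply]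
    have hB : B = 0 := by
      refine halt B (fun g v w => ?_) (fun v => by simp [hBv])
      rw [hBv, hBv]
      refine Fintype.sum_equiv (_root_.Equiv.mulRight g) _ _ fun h => ?_
      simp
    have := hBv v w
    rw [hB, Finset.sum_sub_distrib] at this
    exact sub_eq_zero.mp this.symm
  calc ∑ g, ρ.character (g ^ 2)
      = ∑ g, ∑ i, ∑ j, b.coord i (ρ g (b j)) * b.coord j (ρ g (b i)) := by
        refine Finset.sum_congr rfl fun g _ => ?_
        rw [character, htr]
        refine Finset.sum_congr rfl fun i _ => ?_
        rw [pow_two, map_mul, Module.End.mul_apply]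
        have := congrArg (fun v => b.coord i (ρ g v)) (b.sum_repr (ρ g (b i)))
        rw [← this]
        simp only [map_sum, map_smul, smul_eq_mul, Module.Basis.coord_apply, mul_comm]
    _ = ∑ i, ∑ j, ∑ g, b.coord i (ρ g (b j)) * b.coord j (ρ g (b i)) := by
        rw [Finset.sum_comm]
        exact Finset.sum_congr rfl fun i _ => Finset.sum_comm
    _ = ∑ i, ∑ j, ∑ g, b.coord i (ρ g (b i)) * b.coord j (ρ g (b j)) :=
        Finset.sum_congr rfl fun i _ => Finset.sum_congr rfl fun j _ => hsymm i j _ _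
    _ = ∑ g, ∑ i, ∑ j, b.coord i (ρ g (b i)) * b.coord j (ρ g (b j)) := by
        symm
        rw [Finset.sum_comm]
        exact Finset.sum_congr rfl fun i _ => Finset.sum_comm
    _ = ∑ g, ρ.character g * ρ.character g⁻¹ := by
        refine Finset.sum_congr rfl fun g _ => ?_
        rw [hinv, character, htr, Finset.sum_mul_sum]

/-- An irreducible representation annihilates a class function with which its character pairs
to zero. -/
theorem IsIrreducible.sum_smul_eq_zero (ρ : Representation k G V) [IsIrreducible ρ]
    (f : G → k) (hf : ∀ g h, f (h * g * h⁻¹) = f g) (h0 : ∑ g, f g * ρ.character g = 0) :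
    ∑ g, f g • ρ g = 0 := by
  have hcomm : ∀ h, ρ h * ∑ g, f g • ρ g = (∑ g, f g • ρ g) * ρ h := by
    intro h
    rw [Finset.mul_sum, Finset.sum_mul]
    refine Fintype.sum_equiv (MulAut.conj h).toEquiv _ _ fun g => ?_
    simp [hf, ← map_mul]
  let A : IntertwiningMap ρ ρ := ⟨∑ g, f g • ρ g, fun g => (hcomm g).symm⟩
  obtain ⟨c, hc⟩ := (algebraMap_intertwiningMap_bijective_of_isAlgClosed (ρ := ρ)).2 A
  have hA : ∑ g, f g • ρ g = c • (1 : V →ₗ[k] V) := by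
    change A.toLinearMap = _
    rw [← hc]
    rfl
  have ht := congrArg (LinearMap.trace k V) hA
  simp only [map_sum, map_smul, LinearMap.trace_one, smul_eq_mul] at ht
  have hnt := nontrivial_carrier ρ
  have hd : (Module.finrank k V : k) ≠ 0 := Nat.cast_ne_zero.mpr Module.finrank_pos.ne'
  rw [hA, (mul_eq_zero.mp (ht.symm.trans h0)).resolve_right hd, zero_smul]

/-- A class function orthogonal to all irreducible characters vanishes. -/
theorem eq_zero_of_sum_mul_char_eq_zero (f : G → k) (hf : ∀ g h, f (h * g * h⁻¹) = f g)
    (h0 : ∀ (W : Type) [AddCommGroup W] [Module k W] [FiniteDimensional k W]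
      (σ : Representation k G W) [IsIrreducible σ], ∑ g, f g * σ.character g = 0) :
    f = 0 := by
  have h := sum_smul_eq_zero_of_irreducible f hf
    (fun W _ _ _ σ _ => IsIrreducible.sum_smul_eq_zero σ f hf (h0 W σ)) (leftRegular k G)
  funext g
  classical
  have h1 := congrArg (fun T => T (MonoidAlgebra.single 1 1)) h
  simp only [LinearMap.sum_apply, LinearMap.smul_apply, LinearMap.zero_apply] at h1
  have h2 := congrArg (fun x => x.coeff g) h1
  simpa [MonoidAlgebra.coeff_sum, Finsupp.single_apply] using h2

theorem IsIrreducible.simple_of (ρ : Representation k G V) [IsIrreducible ρ] :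
    Simple (FDRep.of ρ) :=
  (FDRep.simple_iff_char_is_norm_one _).mpr (sum_char_mul_char_inv ρ)

theorem exists_isIrreducible_of_simple (V : FDRep k G) [Simple V] :
    ∃ (W : Type) (_ : AddCommGroup W) (_ : Module k W) (_ : FiniteDimensional k W)
      (σ : Representation k G W), IsIrreducible σ ∧ σ.character = V.character := by
  have hne : (Nat.card G : k) ≠ 0 := Nat.cast_ne_zero.mpr Nat.card_pos.ne'
  have := invertibleOfNonzero hne
  let ρ : Representation k G V := V.ρ
  have hnt : (⟨⊤, fun _ _ _ => Submodule.mem_top⟩ : Subrepresentation ρ).toSubmodule ≠ ⊥ := by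
    intro htop
    have h1 := (FDRep.simple_iff_char_is_norm_one V).mp inferInstance
    have hs : ∀ g, V.character g = 0 := fun g => by
      have : V.ρ g = 0 := by
        ext v
        have : V.ρ g v ∈ (⊤ : Submodule k V) := Submodule.mem_top
        rw [show (⊤ : Submodule k V) = ⊥ from htop] at this
        simpa using this
      rw [FDRep.character, this, map_zero]
    simp only [hs, mul_zero, Finset.sum_const_zero] at h1
    exact hne h1.symm
  obtain ⟨W, -, hW⟩ := Subrepresentation.exists_le_isIrreducible _ hnt
  refine ⟨W.toSubmodule, inferInstance, inferInstance, inferInstance, W.toRepresentation, hW, ?_⟩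
  have hsimple := IsIrreducible.simple_of W.toRepresentation
  have h1 := FDRep.char_orthonormal V (FDRep.of W.toRepresentation)
  have h2 := card_inv_mul_sum_char_mul_char_eq_finrank W.toRepresentation ρ
  by_cases hiso : Nonempty (V ≅ FDRep.of W.toRepresentation)
  · exact (FDRep.char_iso hiso.some).symm
  · exfalso
    rw [if_neg hiso] at h1
    have h3 : (Module.finrank k (IntertwiningMap W.toRepresentation ρ) : k) = 0 := h2.symm.trans h1
    rw [Nat.cast_eq_zero] at h3
    let ι : IntertwiningMap W.toRepresentation ρ := ⟨W.toSubmodule.subtype, fun g => rfl⟩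
    have := Module.finrank_zero_iff.mp h3
    have hι : ι = 0 := Subsingleton.elim _ _
    have hnt := IsIrreducible.nontrivial_carrier W.toRepresentation
    obtain ⟨w, hw⟩ := exists_ne (0 : W.toSubmodule)
    exact hw (Subtype.ext (congrArg (fun F : IntertwiningMap _ _ => F.toLinearMap w) hι))

end FrobeniusSchur

section Perm

variable {k : Type} [Field k] [IsAlgClosed k] [CharZero k]

theorem perm_exists_extendDomain_eq {n : ℕ} (τ : _root_.Equiv.Perm (Fin (n + 1))) (h0 : τ 0 = 0) :
    ∃ σ, _root_.Equiv.Perm.extendDomainHom (finSuccAboveEquiv (0 : Fin (n + 1))) σ = τ := by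
  have hp : ∀ x, τ x ≠ 0 ↔ x ≠ 0 := fun x => by
    rw [not_iff_not]
    exact ⟨fun h => τ.injective (h.trans h0.symm), fun h => h ▸ h0⟩
  let e := (finSuccAboveEquiv (0 : Fin (n + 1)))
  refine ⟨e.symm.permCongr (τ.subtypePerm hp), ?_⟩
  ext x : 1
  by_cases hx : x ≠ 0
  · have := _root_.Equiv.Perm.extendDomain_apply_subtype (e.symm.permCongr (τ.subtypePerm hp)) e hx
    refine this.trans ?_
    simp
  · have := _root_.Equiv.Perm.extendDomain_apply_not_subtype
      (e.symm.permCongr (τ.subtypePerm hp)) e hx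
    refine this.trans ?_
    rw [not_not] at hx
    rw [hx, h0]

/-- No irreducible representation of a symmetric group carries a nonzero invariant
alternating form. -/
theorem perm_eq_zero_of_isAlt (n : ℕ) : ∀ (V : Type) [AddCommGroup V] [Module k V]
    [FiniteDimensional k V] (ρ : Representation k (_root_.Equiv.Perm (Fin n)) V) [IsIrreducible ρ]
    (B : V →ₗ[k] V →ₗ[k] k), (∀ g v w, B (ρ g v) (ρ g w) = B v w) → (∀ v, B v v = 0) → B = 0 := by
  induction n with
  | zero =>
    intro V _ _ _ ρ _ B _ hB0
    have hnt := IsIrreducible.nontrivial_carrier ρ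
    obtain ⟨u, hu⟩ := exists_ne (0 : V)
    have htop := (IsIrreducible.eq_bot_or_eq_top_of_invariant ρ (k ∙ u) (fun g v hv => by
      rw [Subsingleton.elim g 1]
      simpa using hv)).resolve_left (by simpa using hu)
    have hspan : ∀ v : V, ∃ c : k, c • u = v := fun v =>
      Submodule.mem_span_singleton.mp (htop.ge (Submodule.mem_top (x := v)))
    ext v w
    obtain ⟨c, rfl⟩ := hspan v
    obtain ⟨d, rfl⟩ := hspan w
    simp [hB0]
  | succ n ih =>
    intro V _ _ _ ρ _ B hB hB0
    refine IsIrreducible.eq_zero_of_isAlt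
      (_root_.Equiv.Perm.extendDomainHom (finSuccAboveEquiv (0 : Fin (n + 1))))
      (fun g => ?_) ih ρ B hB hB0
    obtain ⟨τ, hτ, hg⟩ := g.exists_conj_eq_inv 0
    obtain ⟨σ, rfl⟩ := perm_exists_extendDomain_eq τ hτ
    exact ⟨σ, hg⟩

omit [IsAlgClosed k] [CharZero k] in
theorem perm_char_inv {α V : Type} [AddCommGroup V] [Module k V]
    (ρ : Representation k (_root_.Equiv.Perm α) V) (g : _root_.Equiv.Perm α) :
    ρ.character g⁻¹ = ρ.character g := by
  by_cases h : Nonempty α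
  · obtain ⟨a⟩ := h
    obtain ⟨τ, -, hτ⟩ := g.exists_conj_eq_inv a
    rw [← hτ, char_conj]
  · have := not_nonempty_iff.mp h
    rw [Subsingleton.elim g⁻¹ g]

end Perm

end Representation

/-- The number of square roots of `g`. -/
noncomputable def sqrtCount {G : Type*} [Group G] (g : G) : ℕ :=
  Nat.card {x : G // x ^ 2 = g}

theorem sqrtCount_conj {G : Type*} [Group G] (g h : G) :
    sqrtCount (h * g * h⁻¹) = sqrtCount g := by
  refine (Nat.card_congr ((MulAut.conj h).toEquiv.subtypeEquiv fun x => ?_)).symm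
  change x ^ 2 = g ↔ (MulAut.conj h x) ^ 2 = h * g * h⁻¹
  rw [← map_pow, ← MulAut.conj_apply, EmbeddingLike.apply_eq_iff_eq]

theorem sum_sqrtCount_mul {G : Type*} [Group G] [Fintype G] (f : G → ℂ) :
    ∑ g, (sqrtCount g : ℂ) * f g = ∑ x, f (x ^ 2) := by
  classical
  rw [← Finset.sum_fiberwise Finset.univ (fun x : G => x ^ 2) (fun x => f (x ^ 2))]
  refine Finset.sum_congr rfl fun g _ => ?_
  have h : ∀ x ∈ ({x | x ^ 2 = g} : Finset G), f (x ^ 2) = f g := fun x hx => by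
    rw [(Finset.mem_filter.mp hx).2]
  rw [Finset.sum_congr rfl h, Finset.sum_const, nsmul_eq_mul, sqrtCount,
    Nat.card_eq_fintype_card, Fintype.card_subtype]

/-- The sum of the irreducible characters of a symmetric group counts square roots. -/
theorem IsIrrFamily.sum_apply_eq_sqrtCount {n : ℕ} {S : Finset (Equiv.Perm (Fin n) → ℂ)}
    (hS : IsIrrFamily (Equiv.Perm (Fin n)) S) (g : Equiv.Perm (Fin n)) :
    ∑ χ ∈ S, χ g = sqrtCount g := by
  have hirr : ∀ χ ∈ S, ∃ (W : Type) (_ : AddCommGroup W) (_ : Module ℂ W)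
      (_ : FiniteDimensional ℂ W) (σ : Representation ℂ (Equiv.Perm (Fin n)) W),
      σ.IsIrreducible ∧ σ.character = χ := fun χ hχ => by
    obtain ⟨V, hV, rfl⟩ := hS.1 χ hχ
    exact Representation.exists_isIrreducible_of_simple V
  have h := Representation.eq_zero_of_sum_mul_char_eq_zero
    (fun g : Equiv.Perm (Fin n) => (sqrtCount g : ℂ) - ∑ χ ∈ S, χ g) ?_ ?_
  · exact (sub_eq_zero.mp (congrFun h g)).symm
  · intro g h
    simp only [sqrtCount_conj]
    congr 1
    refine Finset.sum_congr rfl fun χ hχ => ?_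
    obtain ⟨W, _, _, _, σ, _, rfl⟩ := hirr χ hχ
    exact σ.char_conj g h
  · intro W _ _ _ σ _
    have hmem : σ.character ∈ S :=
      hS.2 _ (Representation.IsIrreducible.simple_of σ)
    simp only [sub_mul, Finset.sum_sub_distrib, sum_sqrtCount_mul]
    rw [Representation.IsIrreducible.sum_char_sq σ (Representation.perm_char_inv σ)
      (Representation.perm_eq_zero_of_isAlt n W σ), sub_eq_zero]
    simp only [Finset.sum_mul]
    rw [Finset.sum_comm, Finset.sum_eq_single_of_mem _ hmem]
    · rw [← Representation.IsIrreducible.sum_char_mul_char_inv σ]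
      simp only [Representation.perm_char_inv]
    · intro χ hχ hne
      obtain ⟨W', _, _, _, τ, _, rfl⟩ := hirr χ hχ
      rw [← Representation.IsIrreducible.sum_char_mul_char_inv_of_ne τ σ hne]
      simp only [Representation.perm_char_inv]

theorem IsIrrFamily.tableSum_eq {n : ℕ} {S : Finset (Equiv.Perm (Fin n) → ℂ)}
    (hS : IsIrrFamily (Equiv.Perm (Fin n)) S) :
    tableSum (Equiv.Perm (Fin n)) S =
      ((∑ᶠ C : ConjClasses (Equiv.Perm (Fin n)), sqrtCount (Quotient.out C) : ℕ) : ℂ) := by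
  have hfin := Fintype.ofFinite (ConjClasses (Equiv.Perm (Fin n)))
  simp only [tableSum, finsum_eq_sum_of_fintype]
  rw [Finset.sum_comm, Nat.cast_sum]
  exact Finset.sum_congr rfl fun C _ => hS.sum_apply_eq_sqrtCount _

theorem sqrtCount_perm_one (α : Type*) [Finite α] :
    sqrtCount (1 : Equiv.Perm α) = numInvolutions (Nat.card α) := by
  let e := (Finite.equivFin α).permCongrHom
  refine Nat.card_congr (e.toEquiv.subtypeEquiv fun x => ?_)
  change x ^ 2 = 1 ↔ e x ^ 2 = 1
  rw [← map_pow, EmbeddingLike.map_eq_one_iff]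

theorem numInvolutions_pos (n : ℕ) : 0 < numInvolutions n :=
  Nat.card_pos_iff.mpr ⟨⟨1, one_pow 2⟩, inferInstance⟩

theorem numInvolutions_mul_le (a b : ℕ) :
    numInvolutions a * numInvolutions b ≤ numInvolutions (a + b) := by
  have h := sqrtCount_perm_one (Fin a ⊕ Fin b)
  rw [Nat.card_sum, Nat.card_fin, Nat.card_fin] at h
  rw [← h, numInvolutions, numInvolutions, ← Nat.card_prod]
  refine Nat.card_le_card_of_injective
    (fun x => ⟨Equiv.Perm.sumCongrHom _ _ (x.1.1, x.2.1), ?_⟩) fun x y hxy => ?_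
  · rw [← map_pow, Prod.pow_mk, x.1.2, x.2.2]
    exact map_one _
  · have := Equiv.Perm.sumCongrHom_injective (Subtype.mk.inj hxy)
    exact Prod.ext (Subtype.ext (congrArg Prod.fst this)) (Subtype.ext (congrArg Prod.snd this))

theorem numInvolutions_mono : Monotone numInvolutions := fun a b h => by
  obtain ⟨c, rfl⟩ := Nat.exists_eq_add_of_le h
  exact (Nat.le_mul_of_pos_right _ (numInvolutions_pos c)).trans (numInvolutions_mul_le a c)

theorem succ_mul_numInvolutions_le (m : ℕ) :
    (m + 1) * numInvolutions m ≤ numInvolutions (m + 2) := by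
  let α := Fin 2 ⊕ Fin m
  have h := sqrtCount_perm_one α
  have hα : Nat.card α = m + 2 := by simp [α, add_comm]
  have hc : Nat.card {k : α // k ≠ Sum.inl 0} = m + 1 := by
    rw [Nat.card_eq_fintype_card, Fintype.card_subtype_compl, Fintype.card_subtype_eq,
      ← Nat.card_eq_fintype_card, hα]
    rfl
  rw [hα] at h
  rw [← h, ← hc, numInvolutions, ← Nat.card_prod]
  let c : α → Equiv.Perm α := fun k => Equiv.swap (Sum.inl 1) k
  let F : α → Equiv.Perm (Fin m) → Equiv.Perm α := fun k x =>
    c k * Equiv.Perm.sumCongrHom _ _ (Equiv.swap 0 1, x) * (c k)⁻¹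
  have hF : ∀ k : {k : α // k ≠ Sum.inl 0}, ∀ x, F k x (Sum.inl 0) = k := fun k x => by
    have : (c k)⁻¹ (Sum.inl 0) = Sum.inl 0 := by
      rw [Equiv.swap_inv]
      exact Equiv.swap_apply_of_ne_of_ne (Sum.inl_injective.ne (by decide)) k.2.symm
    simp only [F, Equiv.Perm.mul_apply, this, Equiv.Perm.sumCongrHom_apply]
    exact Equiv.swap_apply_left _ _
  refine Nat.card_le_card_of_injective (fun x => ⟨F x.1 x.2, ?_⟩) fun x y hxy => ?_
  · rw [conj_pow, ← map_pow, Prod.pow_mk, x.2.2, pow_two, Equiv.swap_mul_self]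
    rw [← Prod.one_eq_mk, map_one, mul_one, mul_inv_cancel]
  · have hxy' := Subtype.mk.inj hxy
    have h1 : x.1 = y.1 := Subtype.ext (by rw [← hF x.1 x.2, hxy', hF])
    rw [h1] at hxy'
    have h2 := Equiv.Perm.sumCongrHom_injective (mul_left_cancel (mul_right_cancel hxy'))
    exact Prod.ext h1 (Subtype.ext (congrArg Prod.snd h2))

theorem factorial_le_numInvolutions_sq (n : ℕ) :
    n.factorial ≤ numInvolutions (n + 1) ^ 2 := by
  induction n using Nat.twoStepInduction with
  | zero => exact Nat.one_le_pow _ _ (numInvolutions_pos _)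
  | one => exact Nat.one_le_pow _ _ (numInvolutions_pos _)
  | more n ih _ =>
    calc (n + 2).factorial = (n + 2) * (n + 1) * n.factorial := by
          rw [Nat.factorial_succ, Nat.factorial_succ, mul_assoc]
      _ ≤ (n + 2) * (n + 2) * numInvolutions (n + 1) ^ 2 := by gcongr; omega
      _ = ((n + 1 + 1) * numInvolutions (n + 1)) ^ 2 := by ring
      _ ≤ numInvolutions (n + 2 + 1) ^ 2 := by
          gcongr
          exact succ_mul_numInvolutions_le (n + 1)

/-- A square root of a fixed-point-free permutation has at most `card β / 3` cycles, and is
determined by its values on a set of representatives of its cycles. -/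
theorem sqrtCount_le_of_forall_ne {β : Type*} [Fintype β] (h : Equiv.Perm β)
    (hh : ∀ b, h b ≠ b) :
    sqrtCount h ≤ 2 ^ Fintype.card β * Fintype.card β ^ (Fintype.card β / 3) := by
  classical
  set j := Fintype.card β with hj
  let reps : Equiv.Perm β → Finset β := fun y =>
    Finset.univ.image fun q : Quotient (Equiv.Perm.SameCycle.setoid y) => q.out
  have hreps : ∀ y b, ∃ t ∈ reps y, y.SameCycle t b := fun y b =>
    ⟨_, Finset.mem_image_of_mem _ (Finset.mem_univ
      (Quotient.mk (Equiv.Perm.SameCycle.setoid y) b)),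
      Quotient.exact (s := Equiv.Perm.SameCycle.setoid y) (Quotient.out_eq _)⟩
  have hcard : ∀ y, y ^ 2 = h → (reps y).card ≤ j / 3 := by
    rintro y rfl
    have hy : ∀ b, y b ≠ b := fun b hb => hh b (by simp [pow_two, hb])
    rw [Nat.le_div_iff_mul_le three_pos]
    refine (Nat.mul_le_mul_right 3 Finset.card_image_le).trans ?_
    rw [Finset.card_univ, ← Fintype.card_fin 3, ← Fintype.card_prod]
    refine Fintype.card_le_of_injective
      (fun x : Quotient (Equiv.Perm.SameCycle.setoid y) × Fin 3 => (y ^ (x.2 : ℕ)) x.1.out) ?_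
    have key : ∀ (a : β) (i k : Fin 3), (y ^ (i : ℕ)) a = (y ^ (k : ℕ)) a → i = k := by
      intro a i k hik
      have h1 := hy a
      have h2 := hh a
      have h3 := hy (y a)
      rw [pow_two, Equiv.Perm.mul_apply] at h2
      fin_cases i <;> fin_cases k <;> simp_all [pow_two, eq_comm]
    rintro ⟨q, i⟩ ⟨r, k⟩ hqr
    replace hqr : (y ^ (i : ℕ)) q.out = (y ^ (k : ℕ)) r.out := hqr
    have hs : y.SameCycle q.out r.out := by
      have h1 : y.SameCycle q.out ((y ^ (i : ℕ)) q.out) := ⟨i, by simp⟩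
      have h2 : y.SameCycle r.out ((y ^ (k : ℕ)) r.out) := ⟨k, by simp⟩
      exact (hqr ▸ h1).trans h2.symm
    have hq : q = r := by
      rw [← Quotient.out_eq q, ← Quotient.out_eq r]
      exact Quotient.sound hs
    subst hq
    exact Prod.ext rfl (key _ _ _ hqr)
  have hinj : sqrtCount h ≤
      Nat.card (Σ T : {T : Finset β // T.card ≤ j / 3}, (T.1 → β)) := by
    refine Nat.card_le_card_of_injective
      (fun y => ⟨⟨reps y.1, hcard _ y.2⟩, fun t => y.1 t⟩) ?_
    rintro ⟨y, hy⟩ ⟨z, hz⟩ hyz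
    have hagree : ∀ t ∈ reps y, y t = z t := by
      intro t ht
      have h1 : reps y = reps z := congrArg (fun s => s.1.1) hyz
      have h2 := congrFun (congrArg
        (fun (s : Σ T : {T : Finset β // T.card ≤ j / 3}, (T.1 → β)) b =>
          if hb : b ∈ s.1.1 then some (s.2 ⟨b, hb⟩) else none) hyz) t
      simp only [dif_pos ht, dif_pos (h1 ▸ ht)] at h2
      exact Option.some.inj h2
    have hstep : ∀ b, y b = z b → y (y b) = z (y b) := fun b hb => by
      conv_rhs => rw [hb]
      rw [← Equiv.Perm.mul_apply, ← Equiv.Perm.mul_apply, ← pow_two, ← pow_two, hy, hz]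
    have hpow : ∀ (i : ℕ) b, y b = z b → y ((y ^ i) b) = z ((y ^ i) b) := by
      intro i b hb
      induction i with
      | zero => exact hb
      | succ i ih =>
        rw [pow_succ', Equiv.Perm.mul_apply]
        exact hstep _ ih
    refine Subtype.ext (Equiv.ext fun b => ?_)
    obtain ⟨t, ht, hs⟩ := hreps y b
    obtain ⟨i, -, -, rfl⟩ := hs.exists_pow_eq'
    exact hpow i t (hagree t ht)
  refine hinj.trans ?_
  rw [Nat.card_eq_fintype_card, Fintype.card_sigma]
  refine (Finset.sum_le_card_nsmul _ _ (j ^ (j / 3)) ?_).trans ?_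
  · rintro ⟨T, hT⟩ -
    rw [Fintype.card_fun, Fintype.card_coe]
    rcases Nat.eq_zero_or_pos j with h0 | h0
    · have hT0 : T.card = 0 := by omega
      rw [← hj, hT0, h0]
    · exact Nat.pow_le_pow_right h0 hT
  · rw [smul_eq_mul]
    gcongr
    rw [Finset.card_univ, ← Fintype.card_finset]
    exact Fintype.card_subtype_le _

theorem sqrtCount_perm_le {α : Type*} [Fintype α] [DecidableEq α] (g : Equiv.Perm α) :
    sqrtCount g ≤ numInvolutions (Fintype.card α - g.support.card) *
      (2 ^ g.support.card * g.support.card ^ (g.support.card / 3)) := by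
  have hcard : Fintype.card {a // ¬ g a = a} = g.support.card := by
    rw [Fintype.card_subtype]
    rfl
  have hcard' : Nat.card {a // g a = a} = Fintype.card α - g.support.card := by
    rw [← hcard, Fintype.card_subtype_compl, Nat.card_eq_fintype_card,
      Nat.sub_sub_self (Fintype.card_subtype_le _)]
  have hg : ∀ x, x ^ 2 = g → ∀ a, g (x a) = x a ↔ g a = a := by
    rintro x rfl a
    have : (x ^ 2) (x a) = x ((x ^ 2) a) := by simp [pow_two]
    rw [this, x.injective.eq_iff]
  have hg' : ∀ x, x ^ 2 = g → ∀ a, ¬ g (x a) = x a ↔ ¬ g a = a := fun x hx a =>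
    not_congr (hg x hx a)
  have hgg : ∀ a, ¬ g (g a) = g a ↔ ¬ g a = a := fun a => not_congr g.injective.eq_iff
  have h2 := sqrtCount_le_of_forall_ne (g.subtypePerm (p := fun a => ¬ g a = a) hgg)
    fun b hb => b.2 (congrArg Subtype.val hb)
  rw [hcard] at h2
  refine le_trans ?_ (Nat.mul_le_mul_left _ h2)
  rw [← hcard', ← sqrtCount_perm_one]
  unfold sqrtCount
  rw [← Nat.card_prod]
  refine Nat.card_le_card_of_injective (fun x =>
    (⟨x.1.subtypePerm (hg x.1 x.2), ?_⟩, ⟨x.1.subtypePerm (hg' x.1 x.2), ?_⟩)) fun x y hxy => ?_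
  · ext a
    exact (congrArg (fun f => f a.1) x.2).trans a.2
  · ext a
    exact congrArg (fun f => f a.1) x.2
  · obtain ⟨h1, h2⟩ := Prod.mk.inj hxy
    refine Subtype.ext (Equiv.ext fun a => ?_)
    by_cases ha : g a = a
    · exact congrArg (fun f => (f.1 ⟨a, ha⟩).1) h1
    · exact congrArg (fun f => (f.1 ⟨a, ha⟩).1) h2

theorem card_filter_conjClasses_support_le (n j : ℕ)
    [Fintype (ConjClasses (Equiv.Perm (Fin n)))] :
    (Finset.univ.filter fun C : ConjClasses (Equiv.Perm (Fin n)) =>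
      (Quotient.out C).support.card = j).card ≤ 2 ^ j := by
  have hpart : Fintype.card (Nat.Partition j) ≤ 2 ^ j := by
    refine (Fintype.card_le_of_surjective _ Nat.Partition.ofComposition_surj).trans ?_
    rw [composition_card]
    exact Nat.pow_le_pow_right two_pos (Nat.sub_le j 1)
  refine le_trans ?_ hpart
  rw [← Fintype.card_subtype]
  refine Fintype.card_le_of_injective
    (fun C => (⟨(Quotient.out C.1).cycleType,
      fun hi => zero_lt_one.trans (Equiv.Perm.one_lt_of_mem_cycleType hi), by
        rw [Equiv.Perm.sum_cycleType, C.2]⟩ : Nat.Partition j)) fun C D h => Subtype.ext ?_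
  have h1 : (Quotient.out C.1).cycleType = (Quotient.out D.1).cycleType :=
    congrArg Nat.Partition.parts h
  rw [← Quotient.out_eq C.1, ← Quotient.out_eq D.1]
  exact Quotient.sound (Equiv.Perm.isConj_iff_cycleType_eq.mpr h1)

theorem numInvolutions_le_finsum_sqrtCount (n : ℕ) :
    numInvolutions n ≤ ∑ᶠ C : ConjClasses (Equiv.Perm (Fin n)), sqrtCount (Quotient.out C) := by
  have hfin := Fintype.ofFinite (ConjClasses (Equiv.Perm (Fin n)))
  rw [finsum_eq_sum_of_fintype]
  refine le_trans (le_of_eq ?_)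
    (Finset.single_le_sum (fun _ _ => Nat.zero_le _) (Finset.mem_univ (ConjClasses.mk 1)))
  have h1 : IsConj (Quotient.out (ConjClasses.mk (1 : Equiv.Perm (Fin n)))) 1 :=
    Quotient.exact (Quotient.out_eq (ConjClasses.mk (1 : Equiv.Perm (Fin n))))
  rw [isConj_one_left.mp h1]
  rfl

theorem finsum_sqrtCount_le (n : ℕ) :
    ∑ᶠ C : ConjClasses (Equiv.Perm (Fin n)), sqrtCount (Quotient.out C) ≤
      numInvolutions n + ∑ j ∈ Finset.Icc 2 n, 4 ^ j * j ^ (j / 3) * numInvolutions (n - j) := by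
  have hfin := Fintype.ofFinite (ConjClasses (Equiv.Perm (Fin n)))
  rw [finsum_eq_sum_of_fintype]
  let supp : ConjClasses (Equiv.Perm (Fin n)) → ℕ := fun C => (Quotient.out C).support.card
  have hle : ∀ C, supp C ≤ n := fun C => (Finset.card_le_univ _).trans_eq (Fintype.card_fin n)
  have hterm : ∀ j, ∑ C with supp C = j, sqrtCount (Quotient.out C) ≤
      4 ^ j * j ^ (j / 3) * numInvolutions (n - j) := fun j => by
    refine (Finset.sum_le_card_nsmul _ _
      (numInvolutions (n - j) * (2 ^ j * j ^ (j / 3))) ?_).trans ?_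
    · intro C hC
      have h := sqrtCount_perm_le (Quotient.out C)
      rwa [show (Quotient.out C).support.card = j from (Finset.mem_filter.mp hC).2,
        Fintype.card_fin] at h
    · rw [smul_eq_mul]
      refine (Nat.mul_le_mul_right _ (card_filter_conjClasses_support_le n j)).trans_eq ?_
      rw [show (4 : ℕ) = 2 * 2 from rfl, mul_pow]
      ring
  have hzero : ∑ C with ¬ 2 ≤ supp C, sqrtCount (Quotient.out C) ≤ numInvolutions n := by
    have hone : ∀ C ∈ Finset.univ.filter (fun C => ¬ 2 ≤ supp C),
        C = ConjClasses.mk 1 ∧ Quotient.out C = 1 := fun C hC => by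
      have h1 := (Finset.mem_filter.mp hC).2
      have h2 := Equiv.Perm.card_support_ne_one (Quotient.out C)
      have h3 : supp C = 0 := by
        have : supp C ≠ 1 := h2
        omega
      have h4 : Quotient.out C = 1 := Equiv.Perm.card_support_eq_zero.mp h3
      refine ⟨?_, h4⟩
      rw [← Quotient.out_eq C, h4]
      rfl
    refine (Finset.sum_le_card_nsmul _ _ (numInvolutions n) fun C hC => ?_).trans ?_
    · rw [(hone C hC).2]
      exact le_rfl
    · have : (Finset.univ.filter (fun C => ¬ 2 ≤ supp C)).card ≤ 1 :=
        Finset.card_le_one.mpr fun C hC D hD => (hone C hC).1.trans (hone D hD).1.symm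
      rw [smul_eq_mul]
      exact (Nat.mul_le_mul_right _ this).trans_eq (one_mul _)
  rw [← Finset.sum_filter_not_add_sum_filter _ (fun C => 2 ≤ supp C)]
  refine add_le_add hzero ?_
  rw [← Finset.sum_fiberwise_of_maps_to (g := supp) (t := Finset.Icc 2 n) fun C hC =>
    Finset.mem_Icc.mpr ⟨(Finset.mem_filter.mp hC).2, hle C⟩]
  refine Finset.sum_le_sum fun j _ => le_trans ?_ (hterm j)
  exact Finset.sum_le_sum_of_subset
    (Finset.filter_subset_filter _ (Finset.filter_subset _ _))

theorem pow_self_le_six_pow_mul_factorial (m : ℕ) :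
    (m + 1) ^ (m + 1) ≤ 6 ^ (m + 1) * m.factorial := by
  have h1 : ((m + 1 : ℕ) : ℝ) ^ (m + 1) / (m + 1).factorial ≤ 3 ^ (m + 1) := by
    refine (Real.pow_div_factorial_le_exp _ (Nat.cast_nonneg _) (m + 1)).trans ?_
    rw [← Real.exp_one_pow]
    exact pow_le_pow_left₀ (Real.exp_pos 1).le Real.exp_one_lt_three.le _
  rw [div_le_iff₀ (Nat.cast_pos.mpr (Nat.factorial_pos _))] at h1
  have h2 : (m + 1) ^ (m + 1) ≤ 3 ^ (m + 1) * (m + 1).factorial := by exact_mod_cast h1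
  refine h2.trans ?_
  rw [Nat.factorial_succ, show (6 : ℕ) = 3 * 2 from rfl, mul_pow, mul_assoc]
  gcongr
  exact Nat.lt_two_pow_self.le

theorem eight_pow_mul_le_numInvolutions {j : ℕ} (hj : 384 ^ 3 ≤ j) :
    8 ^ j * j ^ (j / 3) ≤ numInvolutions j := by
  have hj0 : 0 < j := lt_of_lt_of_le (by norm_num) hj
  have h384 : 384 ^ j ≤ j ^ (j - 2 * (j / 3)) :=
    calc 384 ^ j ≤ 384 ^ (3 * (j - 2 * (j / 3))) := Nat.pow_le_pow_right (by norm_num) (by omega)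
      _ = (384 ^ 3) ^ (j - 2 * (j / 3)) := pow_mul _ _ _
      _ ≤ j ^ (j - 2 * (j / 3)) := Nat.pow_le_pow_left hj _
  have hfact : j ^ j ≤ 6 ^ j * (j - 1).factorial := by
    have := pow_self_le_six_pow_mul_factorial (j - 1)
    rwa [Nat.sub_add_cancel hj0] at this
  have hsq : (j - 1).factorial ≤ numInvolutions j ^ 2 := by
    have := factorial_le_numInvolutions_sq (j - 1)
    rwa [Nat.sub_add_cancel hj0] at this
  refine (Nat.pow_le_pow_iff_left two_ne_zero).mp (le_trans ?_ hsq)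
  refine Nat.le_of_mul_le_mul_left (le_trans ?_ hfact) (pow_pos (by norm_num : 0 < 6) j)
  calc 6 ^ j * (8 ^ j * j ^ (j / 3)) ^ 2 = (6 * 8 ^ 2) ^ j * j ^ (2 * (j / 3)) := by
        rw [mul_pow 6, mul_pow (8 ^ j), ← pow_mul, ← pow_mul, ← pow_mul, mul_comm 2 j,
          mul_comm 2 (j / 3), mul_assoc]
    _ ≤ j ^ (j - 2 * (j / 3)) * j ^ (2 * (j / 3)) := Nat.mul_le_mul_right _ h384
    _ = j ^ j := by
        rw [← pow_add]
        congr 1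
        omega

theorem summable_div_numInvolutions :
    Summable fun j : ℕ => (4 ^ j * j ^ (j / 3) / numInvolutions j : ℝ) := by
  refine Summable.of_norm_bounded_eventually_nat (g := fun j => (1 / 2 : ℝ) ^ j)
    (summable_geometric_of_lt_one (by norm_num) (by norm_num)) ?_
  filter_upwards [eventually_ge_atTop (384 ^ 3)] with j hj
  have h : (8 ^ j * j ^ (j / 3) : ℝ) ≤ numInvolutions j := by
    exact_mod_cast eight_pow_mul_le_numInvolutions hj
  have hpos : (0 : ℝ) < numInvolutions j := Nat.cast_pos.mpr (numInvolutions_pos j)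
  rw [Real.norm_of_nonneg (by positivity), div_le_iff₀ hpos]
  refine le_trans (le_of_eq ?_) (mul_le_mul_of_nonneg_left h (by positivity))
  rw [← mul_assoc, ← mul_pow]
  norm_num

theorem tendsto_numInvolutions_sub_div {j : ℕ} (hj : 2 ≤ j) :
    Tendsto (fun n => (numInvolutions (n - j) / numInvolutions n : ℝ)) atTop (𝓝 0) := by
  rw [← tendsto_add_atTop_iff_nat 2]
  refine squeeze_zero (fun n => by positivity) (fun n => ?_) tendsto_one_div_add_atTop_nhds_zero_nat
  have hpos : (0 : ℝ) < numInvolutions (n + 2) := Nat.cast_pos.mpr (numInvolutions_pos _)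
  rw [div_le_div_iff₀ hpos (by positivity)]
  have h : (n + 1) * numInvolutions (n + 2 - j) ≤ numInvolutions (n + 2) :=
    (Nat.mul_le_mul_left _ (numInvolutions_mono (by omega))).trans (succ_mul_numInvolutions_le n)
  rw [one_mul, mul_comm]
  exact_mod_cast h

theorem tendsto_sum_numInvolutions_div :
    Tendsto (fun n : ℕ =>
      ((∑ j ∈ Finset.Icc 2 n, 4 ^ j * j ^ (j / 3) * numInvolutions (n - j) : ℕ) /
        numInvolutions n : ℝ)) atTop (𝓝 0) := by
  let f : ℕ → ℕ → ℝ := fun n j => if j ∈ Finset.Icc 2 n then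
    4 ^ j * j ^ (j / 3) * (numInvolutions (n - j) / numInvolutions n) else 0
  have hf : ∀ n, ∑' j, f n j = ((∑ j ∈ Finset.Icc 2 n, 4 ^ j * j ^ (j / 3) *
      numInvolutions (n - j) : ℕ) / numInvolutions n : ℝ) := fun n => by
    rw [tsum_eq_sum (s := Finset.Icc 2 n) fun j hj => if_neg hj, Nat.cast_sum, Finset.sum_div]
    refine Finset.sum_congr rfl fun j hj => ?_
    simp only [if_pos hj]
    push_cast
    ring
  have h : Tendsto (fun n => ∑' j, f n j) atTop (𝓝 (∑' _ : ℕ, (0 : ℝ))) :=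
    tendsto_tsum_of_dominated_convergence summable_div_numInvolutions (fun j => ?_)
      (Eventually.of_forall fun n j => ?_)
  · simpa only [hf, tsum_zero] using h
  · by_cases hj : 2 ≤ j
    · refine squeeze_zero (fun n => ?_) (fun n => ?_)
        (by simpa using (tendsto_numInvolutions_sub_div hj).const_mul (4 ^ j * (j : ℝ) ^ (j / 3)))
      · simp only [f]
        split_ifs <;> positivity
      · simp only [f]
        split_ifs
        · exact le_rfl
        · positivity
    · simp [f, hj]
  · simp only [f]
    split_ifs with hj
    · have hn : (0 : ℝ) < numInvolutions n := Nat.cast_pos.mpr (numInvolutions_pos n)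
      have hj0 : (0 : ℝ) < numInvolutions j := Nat.cast_pos.mpr (numInvolutions_pos j)
      have hmul := numInvolutions_mul_le (n - j) j
      rw [Nat.sub_add_cancel (Finset.mem_Icc.mp hj).2] at hmul
      have hratio : (numInvolutions (n - j) / numInvolutions n : ℝ) ≤
          (numInvolutions j : ℝ)⁻¹ := by
        rw [div_le_iff₀ hn, ← div_eq_inv_mul, le_div_iff₀ hj0]
        exact_mod_cast hmul
      rw [Real.norm_of_nonneg (by positivity), div_eq_mul_inv (4 ^ j * (j : ℝ) ^ (j / 3))]
      exact mul_le_mul_of_nonneg_left hratio (by positivity)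
    · rw [norm_zero]
      positivity

/-- The ratio `s_n / i_n` of the character table sum of `S_n` to the number of
involutions in `S_n` converges to `1` as `n → ∞`. -/
theorem tableSum_div_numInvolutions_tendsto_one
    (S : ∀ n : ℕ, Finset (Equiv.Perm (Fin n) → ℂ))
    (hS : ∀ n, IsIrrFamily (Equiv.Perm (Fin n)) (S n)) :
    Tendsto (fun n : ℕ => tableSum (Equiv.Perm (Fin n)) (S n) / (numInvolutions n : ℂ))
      atTop (𝓝 1) := by
  have h := tendsto_sum_numInvolutions_div
  have hpos : ∀ n, (0 : ℝ) < numInvolutions n := fun n => Nat.cast_pos.mpr (numInvolutions_pos n)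
  have hreal : Tendsto (fun n : ℕ =>
      ((∑ᶠ C : ConjClasses (Equiv.Perm (Fin n)), sqrtCount (Quotient.out C) : ℕ) /
        numInvolutions n : ℝ)) atTop (𝓝 1) := by
    refine tendsto_of_tendsto_of_tendsto_of_le_of_le tendsto_const_nhds
      (by simpa using h.const_add (1 : ℝ)) (fun n => ?_) (fun n => ?_)
    · change (1 : ℝ) ≤ _
      rw [one_le_div (hpos n)]
      exact_mod_cast numInvolutions_le_finsum_sqrtCount n
    · rw [div_le_iff₀ (hpos n), add_mul, one_mul, div_mul_cancel₀ _ (hpos n).ne']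
      exact_mod_cast finsum_sqrtCount_le n
  have hcomplex := (Complex.continuous_ofReal.tendsto 1).comp hreal
  rw [Complex.ofReal_one] at hcomplex
  refine hcomplex.congr fun n => ?_
  rw [(hS n).tableSum_eq, Function.comp_apply, Complex.ofReal_div, Complex.ofReal_natCast,
    Complex.ofReal_natCast]
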